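/- Let n ≥ 4 be an integer. For every function f : Z_n → ℝ with f(x) ≥ 0 for all x, the logarithmic Sobolev inequality (1/n)·∑_{x=0}^{n−1} f(x)²·log(f(x)²) − ‖f‖₂²·log(‖f‖₂²) ≤ (2/(1 − cos(2π/n)))·(1/n)·∑_{x=0}^{n−1} f(x)·(f(x) − (1/2)·f(x+1) − (1/2)·f(x−1)) holds, where the arguments x±1 are taken modulo n, ‖f‖₂² = (1/n)·∑_{x=0}^{n−1} f(x)², and the convention 0·log 0 = 0 is used. -/

import Mathlib

lemma lsi_phi_bound (m : ℝ) (hm : 0 ≤ m) :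
    3 * m ^ 2 / (6 + 2 * m) ≤ (1 + m) * Real.log (1 + m) - m := by
  have key : 0 ≤ Real.log (1 + m) - (5 * m ^ 2 + 6 * m) / ((6 + 2 * m) * (1 + m)) := by
    have hmono : MonotoneOn (fun m : ℝ => Real.log (1 + m) - (5 * m ^ 2 + 6 * m) / ((6 + 2 * m) * (1 + m))) (Set.Ici 0) := by
      have hd : ∀ x : ℝ, 0 ≤ x → HasDerivAt (fun m : ℝ => Real.log (1 + m) - (5 * m ^ 2 + 6 * m) / ((6 + 2 * m) * (1 + m)))
          (1 / (1 + x) - ((5 * (2 * x) + 6) * ((6 + 2 * x) * (1 + x)) - (5 * x ^ 2 + 6 * x) * (2 * (1 + x) + (6 + 2 * x) * 1)) / ((6 + 2 * x) * (1 + x)) ^ 2) x := by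
        intro x hx
        have h1 : HasDerivAt (fun m : ℝ => 1 + m) 1 x := by simpa using (hasDerivAt_id x).const_add 1
        have h2 : HasDerivAt (fun m : ℝ => 6 + 2 * m) 2 x := by
          simpa using ((hasDerivAt_id x).const_mul 2).const_add 6
        have h3 : HasDerivAt (fun m : ℝ => 5 * m ^ 2 + 6 * m) (5 * (2 * x) + 6) x := by
          have h4 := ((hasDerivAt_pow 2 x).const_mul (5:ℝ)).add ((hasDerivAt_id x).const_mul (6:ℝ))
          exact h4.congr_deriv (by simp)
        exact (h1.log (by positivity)).sub (h3.div (h2.mul h1) (by positivity))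
      apply monotoneOn_of_deriv_nonneg (convex_Ici 0)
      · intro x hx
        exact (hd x hx).continuousAt.continuousWithinAt
      · intro x hx
        rw [interior_Ici] at hx
        exact (hd x (le_of_lt hx)).differentiableAt.differentiableWithinAt
      · intro x hx
        rw [interior_Ici] at hx
        have hx' : (0:ℝ) < x := hx
        rw [(hd x hx'.le).deriv]
        have : (1 / (1 + x) - ((5 * (2 * x) + 6) * ((6 + 2 * x) * (1 + x)) - (5 * x ^ 2 + 6 * x) * (2 * (1 + x) + (6 + 2 * x) * 1)) / ((6 + 2 * x) * (1 + x)) ^ 2) = 4 * x ^ 3 / ((6 + 2 * x) * (1 + x)) ^ 2 := by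
          field_simp
          ring
        rw [this]; positivity
    have := hmono (Set.mem_Ici.2 le_rfl) (Set.mem_Ici.2 hm) hm
    simpa using this
  have h1 : (5 * m ^ 2 + 6 * m) / ((6 + 2 * m) * (1 + m)) * (1 + m) = 3 * m ^ 2 / (6 + 2 * m) + m := by
    field_simp; ring
  have h2 := mul_nonneg key (by linarith : 0 ≤ 1 + m)
  rw [sub_mul, h1] at h2
  linarith

lemma lsi_cubic_bound (t : ℝ) (ht : 0 ≤ t) :
    t ^ 2 * Real.log (t ^ 2) ≤ 2 * (t - 1) + 3 * (t - 1) ^ 2 + 2 / 3 * (t - 1) ^ 3 := by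
  rcases ht.eq_or_lt with rfl | ht
  · norm_num
  have hd : ∀ x : ℝ, 0 < x → HasDerivAt (fun t : ℝ => ((t - 1) + 3 / 2 * (t - 1) ^ 2 + 1 / 3 * (t - 1) ^ 3) / t ^ 2 - Real.log t)
      ((x - 1) ^ 3 / (3 * x ^ 3)) x := by
    intro x hx
    have h1 : HasDerivAt (fun m : ℝ => m - 1) 1 x := by simpa using (hasDerivAt_id x).sub_const 1
    have h3 := ((h1.add ((h1.pow 2).const_mul (3/2))).add ((h1.pow 3).const_mul (1/3))).div (hasDerivAt_pow 2 x) (by positivity)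
    have h4 := h3.sub (Real.hasDerivAt_log hx.ne')
    refine (h4.congr_deriv ?_)
    simp
    field_simp
    ring
  have key : 0 ≤ ((t - 1) + 3 / 2 * (t - 1) ^ 2 + 1 / 3 * (t - 1) ^ 3) / t ^ 2 - Real.log t := by
    rcases le_total 1 t with h | h
    · have hmono : MonotoneOn (fun t : ℝ => ((t - 1) + 3 / 2 * (t - 1) ^ 2 + 1 / 3 * (t - 1) ^ 3) / t ^ 2 - Real.log t) (Set.Ici 1) := by
        apply monotoneOn_of_deriv_nonneg (convex_Ici 1)
        · intro x hx
          exact (hd x (lt_of_lt_of_le one_pos hx)).continuousAt.continuousWithinAt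
        · intro x hx
          rw [interior_Ici] at hx
          exact (hd x (lt_trans one_pos hx)).differentiableAt.differentiableWithinAt
        · intro x hx
          rw [interior_Ici] at hx
          have hx' : (1:ℝ) < x := hx
          rw [(hd x (by linarith)).deriv]
          have : 0 ≤ x - 1 := by linarith
          positivity
      have := hmono (Set.mem_Ici.2 le_rfl) (Set.mem_Ici.2 h) h
      simpa using this
    · have hmono : AntitoneOn (fun t : ℝ => ((t - 1) + 3 / 2 * (t - 1) ^ 2 + 1 / 3 * (t - 1) ^ 3) / t ^ 2 - Real.log t) (Set.Icc t 1) := by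
        apply antitoneOn_of_deriv_nonpos (convex_Icc t 1)
        · intro x hx
          exact (hd x (lt_of_lt_of_le ht hx.1)).continuousAt.continuousWithinAt
        · intro x hx
          rw [interior_Icc] at hx
          exact (hd x (lt_trans ht hx.1)).differentiableAt.differentiableWithinAt
        · intro x hx
          rw [interior_Icc] at hx
          have hx0 : 0 < x := lt_trans ht hx.1
          rw [(hd x hx0).deriv]
          apply div_nonpos_of_nonpos_of_nonneg _ (by positivity)
          have : x - 1 ≤ 0 := by linarith [hx.2]
          exact Odd.pow_nonpos (by decide) this
      have := hmono ⟨le_rfl, h⟩ ⟨h, le_rfl⟩ h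
      simpa using this
  have h2 := mul_nonneg key (by positivity : 0 ≤ 2 * t ^ 2)
  have h3 : (((t - 1) + 3 / 2 * (t - 1) ^ 2 + 1 / 3 * (t - 1) ^ 3) / t ^ 2 - Real.log t) * (2 * t ^ 2) = 2 * (t - 1) + 3 * (t - 1) ^ 2 + 2 / 3 * (t - 1) ^ 3 - t ^ 2 * (2 * Real.log t) := by
    field_simp
  rw [h3] at h2
  rw [Real.log_pow]
  push_cast
  linarith

lemma lsi_quad (a b c x : ℝ) (hc : 0 < c) (hd : b ^ 2 ≤ 4 * a * c) : 0 ≤ a - b * x + c * x ^ 2 := by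
  have h : 0 ≤ 4 * c * (a - b * x + c * x ^ 2) := by nlinarith [sq_nonneg (2 * c * x - b)]
  exact nonneg_of_mul_nonneg_right h (by linarith)

lemma lsi_caseI_t (A t : ℝ) (hA0 : 0 ≤ A) (ht : 0 ≤ t) (h1 : t ≤ 1) (h2 : A ^ 2 ≤ 2 + t * A) :
    0 ≤ 29/2 * t^2 - 6 * (t + t^2/4 + t^3/2) * A + (29/12*t^2*(1+t^2) + 9/8*(1+t^2)^2) * A^2
      - (t + t^2/4 + t^3/2) * (1+t^2) * A^3 := by
  have hA : A ≤ 2 := by nlinarith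
  have hδ : 0 ≤ (t + t^2/4 + t^3/2) * (1+t^2) := by positivity
  rcases le_total t (35/100) with h | h
  · have h3 : A^3 ≤ 2 * A^2 := by nlinarith [mul_nonneg (sq_nonneg A) (sub_nonneg.2 hA)]
    have h4 := lsi_quad (29/2*t^2) (6 * (t + t^2/4 + t^3/2)) (29/12*t^2*(1+t^2) + 9/8*(1+t^2)^2 - 2 * ((t + t^2/4 + t^3/2) * (1+t^2))) A
      (by nlinarith [sq_nonneg t, mul_nonneg ht ht, pow_nonneg ht 3, pow_nonneg ht 4, pow_nonneg ht 5]) (by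
        have : 36 * (1 + t/4+t^2/2)^2 ≤ 58 * (29/12*t^2*(1+t^2) + 9/8*(1+t^2)^2 - 2 * ((t + t^2/4 + t^3/2) * (1+t^2))) := by
          nlinarith [sq_nonneg t, mul_nonneg ht ht, pow_nonneg ht 3, pow_nonneg ht 4, pow_nonneg ht 5, mul_nonneg (pow_nonneg ht 3) (sub_nonneg.2 h), mul_nonneg (pow_nonneg ht 4) (sub_nonneg.2 h), mul_nonneg ht (sub_nonneg.2 h), sq_nonneg (t - 35/100)]
        nlinarith [mul_le_mul_of_nonneg_left this (sq_nonneg t)])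
    nlinarith [mul_le_mul_of_nonneg_left h3 hδ]
  · have h3 : A^3 ≤ 2 * A + t * A^2 := by nlinarith [mul_nonneg hA0 (sub_nonneg.2 h2)]
    have h4 := lsi_quad (29/2*t^2) ((t + t^2/4 + t^3/2) * (8 + 2 * t^2)) (29/12*t^2*(1+t^2) + 9/8*(1+t^2)^2 - t * ((t + t^2/4 + t^3/2) * (1+t^2))) A
      (by nlinarith [sq_nonneg t, mul_nonneg ht ht, pow_nonneg ht 3, pow_nonneg ht 4, pow_nonneg ht 5, mul_nonneg ht (sub_nonneg.2 h1), mul_nonneg (pow_nonneg ht 2) (sub_nonneg.2 h1), mul_nonneg (pow_nonneg ht 3) (sub_nonneg.2 h1), mul_nonneg (pow_nonneg ht 4) (sub_nonneg.2 h1), mul_nonneg (pow_nonneg ht 5) (sub_nonneg.2 h1)]) (by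
        have : (1 + t/4+t^2/2)^2*(8+2*t^2)^2 ≤ 58 * (29/12*t^2*(1+t^2) + 9/8*(1+t^2)^2 - t * ((t + t^2/4 + t^3/2) * (1+t^2))) := by
          obtain ⟨s, rfl⟩ : ∃ s, t = 35/100 + s := ⟨t - 35/100, by ring⟩
          have hs : 0 ≤ s := by linarith
          have hs1 : 0 ≤ 65/100 - s := by linarith
          nlinarith [pow_nonneg hs 2, pow_nonneg hs 3, pow_nonneg hs 4, mul_nonneg (pow_nonneg hs 1) hs1, mul_nonneg (pow_nonneg hs 2) hs1, mul_nonneg (pow_nonneg hs 3) hs1, mul_nonneg (pow_nonneg hs 4) hs1, mul_nonneg (pow_nonneg hs 5) hs1, mul_nonneg (pow_nonneg hs 6) hs1, mul_nonneg (pow_nonneg hs 7) hs1]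
        nlinarith [mul_le_mul_of_nonneg_left this (sq_nonneg t)])
    nlinarith [mul_le_mul_of_nonneg_left h3 hδ]

lemma lsi_caseI (A u : ℝ) (hu : 0 ≤ u) (h1 : u ≤ A) (h2 : A ^ 2 ≤ 2 + u) :
    (A ^ 2 * u + u ^ 3 / 2 + A * u ^ 2 / 4) * (6 + (A^2 + u^2)) ≤ 29/12 * u^2 * (6 + (A^2 + u^2)) + 9/8 * (A^2+u^2)^2 := by
  rcases (hu.trans h1).eq_or_lt with h | hA
  · have : u = 0 := by linarith
    subst h; subst this; norm_num
  obtain ⟨t, rfl⟩ : ∃ t, u = t * A := ⟨u / A, by field_simp⟩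
  have ht : 0 ≤ t := nonneg_of_mul_nonneg_left hu hA
  have ht1 : t ≤ 1 := by by_contra hh; push Not at hh; nlinarith
  have := lsi_caseI_t A t hA.le ht ht1 h2
  nlinarith [mul_nonneg this (sq_nonneg A)]

lemma lsi_caseII_t (A t : ℝ) (hA0 : 0 ≤ A) (ht : 0 ≤ t) (h1 : t ≤ 1) (h2 : A ^ 2 ≤ 2 + t * A)
    (h3 : t ≤ 3/20 * A * (1 + t^2)) :
    0 ≤ 9/2 * t^2 - 6 * (t/2 + t^2/4) * A + (3/4*t^2*(1+t^2) + 9/10*(1+t^2)^2) * A^2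
      - (t/2 + t^2/4) * (1+t^2) * A^3 - 3/80 * (1+t^2)^3 * A^4 := by
  have hA : A ≤ 2 := by nlinarith
  have ht3 : t ≤ 1/3 := by
    have : t ≤ 3/10 * (1+t^2) := by nlinarith [sq_nonneg t]
    nlinarith
  have hA : A ≤ 8/5 := by nlinarith
  have h5 : A^3 ≤ 8/5 * A^2 := by nlinarith [mul_nonneg (sq_nonneg A) (sub_nonneg.2 hA)]
  have h6 : A^4 ≤ 64/25 * A^2 := by nlinarith [mul_nonneg (sq_nonneg A) (sub_nonneg.2 hA), mul_nonneg (mul_nonneg (sq_nonneg A) (sub_nonneg.2 hA)) hA0]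
  have hk : 1/2 * (1+t/2)^2 ≤ (9/10*(1+t^2)^2 + 3/4*t^2*(1+t^2) - 8/5*((t/2 + t^2/4) * (1+t^2)) - 64/25 * (3/80 * (1+t^2)^3)) := by
    have hs1 : 0 ≤ 1/3 - t := by linarith
    nlinarith [pow_nonneg ht 2, pow_nonneg ht 3, pow_nonneg ht 4, mul_nonneg (pow_nonneg ht 1) hs1, mul_nonneg (pow_nonneg ht 2) hs1, mul_nonneg (pow_nonneg ht 3) hs1, mul_nonneg (pow_nonneg ht 4) hs1, mul_nonneg (pow_nonneg ht 5) hs1]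
  have h4 := lsi_quad (9/2*t^2) (6 * (t/2 + t^2/4)) (9/10*(1+t^2)^2 + 3/4*t^2*(1+t^2) - 8/5*((t/2 + t^2/4) * (1+t^2)) - 64/25 * (3/80 * (1+t^2)^3)) A
    (by nlinarith) (by nlinarith [mul_le_mul_of_nonneg_left hk (sq_nonneg t)])
  have hδ : 0 ≤ (t/2 + t^2/4) * (1+t^2) := by positivity
  have hε : 0 ≤ 3/80 * (1+t^2)^3 := by positivity
  nlinarith [mul_le_mul_of_nonneg_left h5 hδ, mul_le_mul_of_nonneg_left h6 hε]

lemma lsi_caseII (A u : ℝ) (hu : 0 ≤ u) (h1 : u ≤ A) (h2 : A ^ 2 ≤ 2 + u) (h3 : u ≤ 3/20 * (A^2+u^2)) :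
    (A ^ 2 * u / 2 + A * u ^ 2 / 4 + 3/80 * (A^2+u^2)^2) * (6 + (A^2 + u^2)) ≤ 3/4 * u^2 * (6 + (A^2 + u^2)) + 9/8 * (A^2+u^2)^2 := by
  rcases (hu.trans h1).eq_or_lt with h | hA
  · have : u = 0 := by linarith
    subst h; subst this; norm_num
  obtain ⟨t, rfl⟩ : ∃ t, u = t * A := ⟨u / A, by field_simp⟩
  have ht : 0 ≤ t := nonneg_of_mul_nonneg_left hu hA
  have ht1 : t ≤ 1 := by by_contra hh; push Not at hh; nlinarith
  have := lsi_caseII_t A t hA.le ht ht1 h2 (by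
    refine le_of_mul_le_mul_right ?_ hA
    linarith)
  nlinarith [mul_nonneg this (sq_nonneg A)]

lemma lsi_caseIII (A u : ℝ) (hA : 0 ≤ A) (h1 : A ≤ u) (hA2 : A ≤ 2) (h3 : u ≤ 3) :
    (A ^ 2 * u / 2 + u ^ 3 / 2 + A ^ 3 / 4 + A * u^2/2) * (6 + (A^2 + u^2)) ≤ 29/12 * u^2 * (6 + (A^2 + u^2)) + 9/8 * (A^2+u^2)^2 := by
  rcases le_total u 2 with h | h
  · rcases (hA.trans h1).eq_or_lt with hz | hu
    · have : A = 0 := by linarith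
      subst hz; subst this; norm_num
    obtain ⟨t, rfl⟩ : ∃ t, A = t * u := ⟨A / u, by field_simp⟩
    have ht : 0 ≤ t := nonneg_of_mul_nonneg_left hA hu
    have ht1 : t ≤ 1 := by by_contra hh; push Not at hh; nlinarith
    have hs1 : 0 ≤ 1 - t := by linarith
    have h5 : u^3 ≤ 2 * u^2 := by nlinarith [mul_nonneg (sq_nonneg u) (sub_nonneg.2 h)]
    have hk : 36 * (1/2+t/2+t^2/2+t^3/4)^2 ≤ 58 * ((1+t^2)*(29/12 + 9/8*(1+t^2) - 2 * (1/2+t/2+t^2/2+t^3/4))) := by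
      nlinarith [pow_nonneg ht 2, pow_nonneg ht 3, pow_nonneg ht 4, mul_nonneg (pow_nonneg ht 1) hs1, mul_nonneg (pow_nonneg ht 2) hs1, mul_nonneg (pow_nonneg ht 3) hs1, mul_nonneg (pow_nonneg ht 4) hs1, mul_nonneg (pow_nonneg ht 5) hs1]
    have h4 := lsi_quad (29/2) (6 * (1/2+t/2+t^2/2+t^3/4)) ((1+t^2)*(29/12 + 9/8*(1+t^2) - 2 * (1/2+t/2+t^2/2+t^3/4))) u
      (by
        have : 0 < (1/2+t/2+t^2/2+t^3/4)^2 := by positivity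
        linarith) (by linarith)
    have hδ : 0 ≤ (1/2+t/2+t^2/2+t^3/4) * (1+t^2) := by positivity
    have h6 := mul_nonneg (sub_nonneg.2 (mul_le_mul_of_nonneg_left h5 hδ)) (sq_nonneg u)
    have h7 := mul_nonneg h4 (sq_nonneg u)
    nlinarith
  · have hN : 0 < 6 + (A^2+u^2) := by positivity
    have hq : 2/5 * ((27/10 : ℝ)) ≥ 0 := by norm_num
    have h5 : (2*(58/100)*(A^2+u^2) - (58/100)^2*(6+(A^2+u^2))) * (6+(A^2+u^2)) ≤ (A^2+u^2)^2 := by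
      nlinarith [sq_nonneg ((A^2+u^2) - 58/100*(6+(A^2+u^2)))]
    have h6 : A ^ 2 * u / 2 + u ^ 3 / 2 + A ^ 3 / 4 + A * u^2/2 ≤ 29/12*u^2 + 9/8 * (2*(58/100)*(A^2+u^2) - (58/100)^2*(6+(A^2+u^2))) := by
      have hx : 0 ≤ 2 - A := by linarith
      have hy : 0 ≤ u - 2 := by linarith
      have hz : 0 ≤ 3 - u := by linarith
      have e1 : A^2*u/2 + A^3/4 + A*u^2/2 - 9/8*(2*(58/100) - (58/100)^2)*A^2 ≤ 2*u + 2 + u^2 - 9/8*(2*(58/100) - (58/100)^2)*4 := by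
        nlinarith [mul_nonneg hx hy, mul_nonneg (mul_nonneg hx hA) hy, mul_nonneg hx hA, mul_nonneg hx (mul_nonneg hA hA), mul_nonneg hx (mul_nonneg hy hy)]
      nlinarith [mul_nonneg hy hz, mul_nonneg hy (mul_nonneg hy hz)]
    nlinarith [mul_le_mul_of_nonneg_right h6 hN.le]

lemma lsi_final (A R u C D Φ : ℝ) (hA : 0 ≤ A) (hA2 : A ≤ 2) (hu : 0 ≤ u) (huR : u ≤ R)
    (hC : C ≤ u / 2) (hAC : A ^ 2 ≤ 2 + 2 * C) (hm : (A ^ 2 + u ^ 2) / 2 ≤ A + R)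
    (hD : 5 / 3 * R ^ 2 + 3 / 4 * u ^ 2 ≤ 3 * D)
    (hΦ : 3 * ((A ^ 2 + u ^ 2) / 2) ^ 2 / (6 + 2 * ((A ^ 2 + u ^ 2) / 2)) ≤ Φ) :
    A ^ 2 * C + A * (u ^ 2 / 2 - C ^ 2) + R * ((A ^ 2 + u ^ 2) / 2) ≤ 3 * D + 3 / 2 * Φ := by
  have hN : 0 < 6 + (A ^ 2 + u ^ 2) := by positivity
  have hP : ∀ X Y : ℝ, X * (6 + (A^2+u^2)) ≤ Y * (6 + (A^2+u^2)) + 9/8 * (A^2+u^2)^2 → X ≤ Y + 3/2 * Φ := by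
    intro X Y h
    have h1 : 3/2 * (3 * ((A ^ 2 + u ^ 2) / 2) ^ 2 / (6 + 2 * ((A ^ 2 + u ^ 2) / 2))) * (6 + (A^2+u^2)) = 9/8 * (A^2+u^2)^2 := by
      have : 6 + 2 * ((A ^ 2 + u ^ 2) / 2) = 6 + (A^2+u^2) := by ring
      rw [this]; field_simp; ring
    have h2 : X ≤ Y + 3/2 * (3 * ((A ^ 2 + u ^ 2) / 2) ^ 2 / (6 + 2 * ((A ^ 2 + u ^ 2) / 2))) := by
      refine le_of_mul_le_mul_right ?_ hN
      rw [add_mul, h1]; exact h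
    linarith
  have hcub : A^2 * C - A * C^2 ≤ A^3/4 := by nlinarith [mul_nonneg hA (sq_nonneg (C - A/2))]
  rcases le_total 9 (A^2+u^2) with hbig | hsmall
  · -- large regime
    have hR : (A^2+u^2)/2 - 2 ≤ R := by linarith
    obtain ⟨m, hm'⟩ : ∃ m, m = (A^2+u^2)/2 := ⟨_, rfl⟩
    rw [← hm'] at hR ⊢
    have hm9 : 9/2 ≤ m := by rw [hm']; linarith
    have e1 : (m - 2) * (2*m - 10)/3 ≤ 5/3 * R^2 - R * m := by nlinarith
    have hu2 : u^2 = 2*m - A^2 := by rw [hm']; ring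
    have e2 : A * (u^2/2) + A^3/4 ≤ u^2 + 2 := by
      have : A^3 ≤ 8 := by nlinarith [mul_nonneg hA (sub_nonneg.2 hA2), sq_nonneg A]
      nlinarith [mul_nonneg (sub_nonneg.2 hA2) (sq_nonneg u)]
    have e3 : (m - 2) * (10 - 2*m)/3 + (u^2 + 2) - 3/4*u^2 ≤ 0 + 3/2*Φ := by
      apply hP
      have hN' : A^2+u^2 = 2*m := by rw [hm']; ring
      rw [hN']
      have hu3 : u^2 ≤ 2*m := by rw [hu2]; nlinarith [sq_nonneg A]
      have : ((m - 2) * (10 - 2*m)/3 + (m/2 + 2)) * (6+2*m) ≤ 9/8*(2*m)^2 := by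
        nlinarith [sq_nonneg (m-9/2), mul_nonneg (sub_nonneg.2 hm9) (sub_nonneg.2 hm9), mul_nonneg (sub_nonneg.2 hm9) (sq_nonneg (m-9/2))]
      have h9 := mul_le_mul_of_nonneg_right hu3 (by linarith : 0 ≤ 6 + 2*m)
      linarith
    linarith
  have hu3 : u ≤ 3 := by nlinarith [sq_nonneg A]
  rcases le_total u A with h | h
  · have e0 : A^2 * C - A * C^2 ≤ A^2*(u/2) - A*(u/2)^2 := by
      have : 0 ≤ A * ((u/2 - C) * (A - u/2 - C)) := mul_nonneg hA (mul_nonneg (by linarith) (by linarith))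
      linarith
    have hA2' : A^2 ≤ 2 + u := by linarith
    rcases le_total u (3/20 * (A^2+u^2)) with h3 | h3
    · have := hP _ _ (lsi_caseII A u hu h hA2' h3)
      have e9 := sq_nonneg (R - 3/20*(A^2+u^2))
      linarith
    · have := hP _ _ (lsi_caseI A u hu h hA2')
      have e1 : 5/3*u^2 - u * ((A^2+u^2)/2) ≤ 5/3 * R^2 - R * ((A^2+u^2)/2) := by
        have : 0 ≤ (R-u)*(5/3*(R+u) - (A^2+u^2)/2) := mul_nonneg (by linarith) (by linarith)
        linarith
      linarith
  · have := hP _ _ (lsi_caseIII A u hA h hA2 hu3)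
    have e1 : 5/3*u^2 - u * ((A^2+u^2)/2) ≤ 5/3 * R^2 - R * ((A^2+u^2)/2) := by
      have : 0 ≤ (R-u)*(5/3*(R+u) - (A^2+u^2)/2) := mul_nonneg (by linarith) (by nlinarith)
      linarith
    linarith

lemma lsi_four (P R Φ : ℝ) (hP : 0 ≤ P) (hR : 0 ≤ R) (hR1 : R ≤ 1) (h : P ≤ (1 + R) ^ 2)
    (hΦ : 3 * (P / 2 + R ^ 2) ^ 2 / (6 + 2 * (P / 2 + R ^ 2)) ≤ Φ) : R * P ≤ 2 * R ^ 2 + Φ := by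
  obtain ⟨m, hm⟩ : ∃ m, m = P / 2 + R ^ 2 := ⟨_, rfl⟩
  rw [← hm] at hΦ
  have hPm : P = 2 * m - 2 * R^2 := by rw [hm]; ring
  have hm0 : 0 ≤ m := by rw [hm]; positivity
  have hmR : R^2 ≤ m := by linarith
  have hm1 : m ≤ (1+R)^2/2 + R^2 := by linarith
  have key : (2*m*R - 2*R^3 - 2*R^2) * (6+2*m) ≤ 3*m^2 := by
    rcases le_total R (1/3) with hs | hs
    · have := lsi_quad (12*R^3+12*R^2) (12*R-4*R^3-4*R^2) (3-4*R) m (by linarith) (by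
        have : R^4+2*R^3+7*R^2-3*R ≤ 0 := by
          have : R^3+2*R^2+7*R-3 ≤ 0 := by nlinarith [sq_nonneg R]
          nlinarith
        nlinarith [mul_nonneg (sq_nonneg R) (neg_nonneg.2 this)])
      nlinarith
    · have hu : 0 ≤ 3/4 - 4*R + 11/2*R^2 - R^3 + 19/4*R^4 - 3*R^5 := by
        nlinarith [mul_nonneg (pow_nonneg hR 4) (sub_nonneg.2 hR1), sq_nonneg (R - 37/100), sq_nonneg (R * (R - 37/100)), sq_nonneg (R^2 - 37/100*37/100)]
      have hd : 3 - 10*R + 5*R^2 - 8*R^3 ≤ 0 := by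
        nlinarith [mul_nonneg (sub_nonneg.2 hs) (sub_nonneg.2 hR1), mul_nonneg hR (mul_nonneg (sub_nonneg.2 hs) (sub_nonneg.2 hR1))]
      have hm2 : 0 ≤ (1+R)^2/2 + R^2 - m := by linarith
      rcases le_total R (3/4) with h4 | h4
      · have h5 : 0 ≤ (3 - 4*R) * ((1+R)^2/2 + R^2 - m)^2 := mul_nonneg (by linarith) (sq_nonneg _)
        have h6 := mul_nonneg hm2 (neg_nonneg.2 hd)
        linarith
      · have h5 : (3-4*R)*(m + ((1+R)^2/2+R^2)) - 12*R+4*R^2+4*R^3 ≤ 0 := by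
          have h7 : (3-4*R)*(m + ((1+R)^2/2+R^2)) ≤ 0 := mul_nonpos_of_nonpos_of_nonneg (by linarith) (by positivity)
          nlinarith
        have h6 := mul_nonneg hm2 (neg_nonneg.2 h5)
        linarith
  have : 2*m*R - 2*R^3 - 2*R^2 ≤ 3*m^2/(6+2*m) := by
    rw [le_div_iff₀ (by positivity)]; exact key
  rw [hPm]; nlinarith
open Finset in
noncomputable def lsiE (n : ℕ) (g : ℕ → ℝ) : ℝ := ∑ x ∈ range n, g x / n

open Finset in
lemma lsiE_nonneg (n : ℕ) (g : ℕ → ℝ) (hg : ∀ x < n, 0 ≤ g x) : 0 ≤ lsiE n g :=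
  sum_nonneg (fun x hx => div_nonneg (hg x (mem_range.1 hx)) (by positivity))

open Finset in
lemma lsi_abstract (n : ℕ) (h p : ℕ → ℝ) (A R D Φ m : ℝ)
    (hE1 : lsiE n (fun _ => 1) = 1)
    (hp1 : lsiE n (fun x => p x) = 0) (hp2 : lsiE n (fun x => p x ^ 2) = 1/2)
    (hp3 : lsiE n (fun x => p x ^ 3) = 0) (hp4 : lsiE n (fun x => p x ^ 4) = 3/8)
    (hple : ∀ x, p x ≤ 1)
    (hh : lsiE n (fun x => h x) = 0) (hm : lsiE n (fun x => h x ^ 2) = m)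
    (hhp : lsiE n (fun x => h x * p x) = A/2) (hA : 0 ≤ A) (hR : 0 ≤ R)
    (hh1 : ∀ x < n, -1 ≤ h x) (hr : ∀ x < n, h x - A * p x ≤ R)
    (hD : 5/9 * R^2 + (m - A^2/2)/2 ≤ D) (hρR : 2 * (m - A^2/2) ≤ R^2)
    (hΦ : 3 * m^2/(6+2*m) ≤ Φ) :
    lsiE n (fun x => h x ^ 3) ≤ 3 * D + 3/2 * Φ := by
  obtain ⟨H2, hH2⟩ : ∃ H2, lsiE n (fun x => h x * p x ^ 2) = H2 := ⟨_, rfl⟩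
  obtain ⟨H3, hH3⟩ : ∃ H3, lsiE n (fun x => h x * p x ^ 3) = H3 := ⟨_, rfl⟩
  obtain ⟨K, hK⟩ : ∃ K, lsiE n (fun x => h x ^ 2 * p x) = K := ⟨_, rfl⟩
  obtain ⟨T, hT⟩ : ∃ T, lsiE n (fun x => h x ^ 3) = T := ⟨_, rfl⟩
  have hρ0 : lsiE n (fun x => (h x - A * p x)^2) = m - A^2/2 := by
    have : lsiE n (fun x => (h x - A * p x)^2) = lsiE n (fun x => h x ^ 2) - (2*A) * lsiE n (fun x => h x * p x)
        + A^2 * lsiE n (fun x => p x ^ 2) := by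
      simp only [lsiE, mul_sum, ← sum_add_distrib, ← sum_sub_distrib]
      exact sum_congr rfl (fun x _ => by ring)
    rw [this, hm, hhp, hp2]; ring
  have hρ : 0 ≤ m - A^2/2 := by
    rw [← hρ0]; exact lsiE_nonneg _ _ (fun x _ => by positivity)
  have hCS : 2 * (2*H2)^2 ≤ m - A^2/2 := by
    have : lsiE n (fun x => (h x - A * p x - 2 * (2*H2) * (2 * p x ^ 2 - 1))^2)
        = lsiE n (fun x => (h x - A * p x)^2) - (16*H2) * lsiE n (fun x => h x * p x ^ 2)
        + (8*H2) * lsiE n (fun x => h x) + (16 * H2 * A) * lsiE n (fun x => p x ^ 3)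
        - (8 * H2 * A) * lsiE n (fun x => p x) + (64 * H2^2) * lsiE n (fun x => p x ^ 4)
        - (64*H2^2) * lsiE n (fun x => p x ^ 2) + (16 * H2^2) * lsiE n (fun _ => 1) := by
      simp only [lsiE, mul_sum, ← sum_add_distrib, ← sum_sub_distrib]
      exact sum_congr rfl (fun x _ => by ring)
    have h0 := lsiE_nonneg n (fun x => (h x - A * p x - 2 * (2*H2) * (2 * p x ^ 2 - 1))^2) (fun x _ => by positivity)
    rw [this, hρ0, hH2, hh, hp3, hp1, hp4, hp2, hE1] at h0
    linarith
  have hW : K - A * (2 * H2) ≤ (m - A^2/2) - (2*H2)^2 := by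
    have : lsiE n (fun x => (1 - p x) * (h x - A * p x + (2*H2) * (2 * p x + 1))^2)
        = lsiE n (fun x => (h x - A * p x)^2) - lsiE n (fun x => h x ^ 2 * p x) + (2*A) * lsiE n (fun x => h x * p x ^ 2)
          - A^2 * lsiE n (fun x => p x ^ 3)
          + (4*H2) * lsiE n (fun x => h x) + (4*H2) * lsiE n (fun x => h x * p x) - (8*H2) * lsiE n (fun x => h x * p x ^ 2)
          - (4*H2*A) * lsiE n (fun x => p x) - (4*H2*A) * lsiE n (fun x => p x^2) + (8*H2*A) * lsiE n (fun x => p x^3)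
          + (4*H2^2) * lsiE n (fun _ => 1) + (12*H2^2) * lsiE n (fun x => p x) - (16*H2^2) * lsiE n (fun x => p x^3) := by
      simp only [lsiE, mul_sum, ← sum_add_distrib, ← sum_sub_distrib]
      exact sum_congr rfl (fun x _ => by ring)
    have h0 := lsiE_nonneg n (fun x => (1 - p x) * (h x - A * p x + (2*H2) * (2 * p x + 1))^2)
      (fun x _ => mul_nonneg (by linarith [hple x]) (by positivity))
    rw [this, hρ0, hH2, hh, hp3, hp1, hp2, hE1, hK, hhp] at h0
    linarith
  have hA2 : A^2 ≤ 2 + 2 * (2*H2) := by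
    have : lsiE n (fun x => (1 + h x) * (p x - A/2)^2)
        = lsiE n (fun x => p x ^2) - A * lsiE n (fun x => p x) + (A^2/4) * lsiE n (fun _ => 1)
          + lsiE n (fun x => h x * p x ^ 2) - A * lsiE n (fun x => h x * p x) + (A^2/4) * lsiE n (fun x => h x) := by
      simp only [lsiE, mul_sum, ← sum_add_distrib, ← sum_sub_distrib]
      exact sum_congr rfl (fun x _ => by ring)
    have h0 := lsiE_nonneg n (fun x => (1 + h x) * (p x - A/2)^2)
      (fun x hx => mul_nonneg (by linarith [hh1 x hx]) (by positivity))
    rw [this, hp2, hp1, hE1, hH2, hhp, hh] at h0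
    linarith
  have hAle : A ≤ 2 := by
    have : lsiE n (fun x => (1 + h x) * (1 - p x))
        = lsiE n (fun _ => 1) - lsiE n (fun x => p x) + lsiE n (fun x => h x) - lsiE n (fun x => h x * p x) := by
      simp only [lsiE, ← sum_add_distrib, ← sum_sub_distrib]
      exact sum_congr rfl (fun x _ => by ring)
    have h0 := lsiE_nonneg n (fun x => (1 + h x) * (1 - p x))
      (fun x hx => mul_nonneg (by linarith [hh1 x hx]) (by linarith [hple x]))
    rw [this, hE1, hp1, hh, hhp] at h0
    linarith
  have hmle : m ≤ A + R := by
    have : lsiE n (fun x => (1 + h x) * (A + R - h x))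
        = (A + R) * lsiE n (fun _ => 1) + (A + R - 1) * lsiE n (fun x => h x) - lsiE n (fun x => h x ^ 2) := by
      simp only [lsiE, mul_sum, ← sum_add_distrib, ← sum_sub_distrib]
      exact sum_congr rfl (fun x _ => by ring)
    have h0 := lsiE_nonneg n (fun x => (1 + h x) * (A + R - h x))
      (fun x hx => mul_nonneg (by linarith [hh1 x hx]) (by nlinarith [hple x, hr x hx]))
    rw [this, hE1, hh, hm] at h0
    linarith
  have hT1 : T - A * K ≤ R * m := by
    have : lsiE n (fun x => h x ^ 2 * (R - (h x - A * p x)))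
        = R * lsiE n (fun x => h x ^ 2) - lsiE n (fun x => h x ^ 3) + A * lsiE n (fun x => h x ^ 2 * p x) := by
      simp only [lsiE, mul_sum, ← sum_add_distrib, ← sum_sub_distrib]
      exact sum_congr rfl (fun x _ => by ring)
    have h0 := lsiE_nonneg n (fun x => h x ^ 2 * (R - (h x - A * p x)))
      (fun x hx => mul_nonneg (by positivity) (by linarith [hr x hx]))
    rw [this, hm, hT, hK] at h0
    linarith
  rw [hT]
  have hu2 : Real.sqrt (2 * (m - A^2/2)) ^ 2 = 2 * (m - A^2/2) := Real.sq_sqrt (by linarith)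
  obtain ⟨u, hu⟩ : ∃ u, u = Real.sqrt (2 * (m - A^2/2)) := ⟨_, rfl⟩
  rw [← hu] at hu2
  have hu0 : 0 ≤ u := by rw [hu]; positivity
  have hmu : (A^2 + u^2)/2 = m := by rw [hu2]; ring
  have huR : u ≤ R := by
    apply le_of_sq_le_sq _ hR
    linarith
  have hCu : 2 * H2 ≤ u/2 := by
    apply le_of_sq_le_sq _ (by linarith)
    nlinarith
  have F := lsi_final A R u (2*H2) D Φ hA hAle hu0 huR hCu hA2 (by rw [hmu]; exact hmle) (by rw [hu2]; linarith)
    (by rw [hmu]; exact hΦ)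
  rw [hmu, hu2] at F
  nlinarith

open Finset in
lemma lsi_geom (n : ℕ) (z : ℂ) (hz : z ^ n = 1) (h1 : z ≠ 1) : ∑ k ∈ range n, z ^ k = 0 := by
  rw [geom_sum_eq h1, hz]; simp

noncomputable def lsiW (n : ℕ) : ℂ := Complex.exp (2 * Real.pi * Complex.I / n)

lemma lsiW_prim (n : ℕ) (hn : n ≠ 0) : IsPrimitiveRoot (lsiW n) n := Complex.isPrimitiveRoot_exp n hn

lemma lsiW_pow (n k : ℕ) : lsiW n ^ k = Complex.exp ((2 * Real.pi / n * k : ℝ) * Complex.I) := by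
  unfold lsiW
  rw [← Complex.exp_nat_mul]; congr 1; push_cast; ring

lemma lsiW_re (n k : ℕ) : (lsiW n ^ k).re = Real.cos (2 * Real.pi / n * k) := by
  rw [lsiW_pow, Complex.exp_ofReal_mul_I_re]

lemma lsiW_im (n k : ℕ) : (lsiW n ^ k).im = Real.sin (2 * Real.pi / n * k) := by
  rw [lsiW_pow, Complex.exp_ofReal_mul_I_im]

lemma lsiW_norm (n k : ℕ) : ‖lsiW n ^ k‖ = 1 := by
  rw [lsiW_pow, Complex.norm_exp_ofReal_mul_I]

lemma lsiW_conj (n k : ℕ) : (starRingEnd ℂ) (lsiW n ^ k) = (lsiW n ^ k)⁻¹ := by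
  rw [Complex.inv_def, Complex.normSq_eq_norm_sq, lsiW_norm]; simp

open Finset in
lemma lsi_orth (n : ℕ) (hn : n ≠ 0) (x y : ℕ) (hx : x < n) (hy : y < n) :
    ∑ k ∈ range n, lsiW n ^ (k * x) * (starRingEnd ℂ) (lsiW n ^ (k * y)) = if x = y then (n : ℂ) else 0 := by
  have h0 : ∀ k, lsiW n ^ (k * x) * (starRingEnd ℂ) (lsiW n ^ (k * y)) = (lsiW n ^ x * (lsiW n ^ y)⁻¹) ^ k := by
    intro k
    rw [lsiW_conj, mul_pow, inv_pow, ← pow_mul, ← pow_mul, mul_comm k x, mul_comm k y]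
  have hne : lsiW n ^ y ≠ 0 := by
    intro h; have := lsiW_norm n y; rw [h] at this; simp at this
  simp_rw [h0]
  split_ifs with h
  · subst h
    rw [mul_inv_cancel₀ hne]; simp
  · apply lsi_geom
    · rw [mul_pow, inv_pow, ← pow_mul, ← pow_mul, mul_comm x n, mul_comm y n, pow_mul, pow_mul,
        (lsiW_prim n hn).pow_eq_one]; simp
    · intro h1
      rw [mul_inv_eq_one₀ hne] at h1
      exact h ((lsiW_prim n hn).pow_inj hx hy h1)

open Finset in
noncomputable def lsiC (n : ℕ) (h : ℕ → ℝ) (k : ℕ) : ℂ := ∑ x ∈ range n, (h x : ℂ) * lsiW n ^ (k * x)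

open Finset in
lemma lsi_inversion (n : ℕ) (hn : n ≠ 0) (h : ℕ → ℝ) (y : ℕ) (hy : y < n) :
    ∑ k ∈ range n, lsiC n h k * (starRingEnd ℂ) (lsiW n ^ (k * y)) = n * h y := by
  unfold lsiC
  simp_rw [sum_mul]
  rw [sum_comm]
  have : ∀ x ∈ range n, ∑ k ∈ range n, (h x : ℂ) * lsiW n ^ (k * x) * (starRingEnd ℂ) (lsiW n ^ (k * y))
      = if x = y then (n : ℂ) * h y else 0 := by
    intro x hx
    simp_rw [mul_assoc]
    rw [← mul_sum, lsi_orth n hn x y (mem_range.1 hx) hy]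
    split_ifs with h1
    · subst h1; ring
    · simp
  rw [sum_congr rfl this]
  simp [hy]

open Finset in
lemma lsi_parseval (n : ℕ) (hn : n ≠ 0) (h : ℕ → ℝ) :
    ∑ k ∈ range n, ‖lsiC n h k‖ ^ 2 = n * ∑ x ∈ range n, h x ^ 2 := by
  have h1 : ((∑ k ∈ range n, ‖lsiC n h k‖ ^ 2 : ℝ) : ℂ) = ((n * ∑ x ∈ range n, h x ^ 2 : ℝ) : ℂ) := by
    push_cast
    have : ∀ k ∈ range n, ((‖lsiC n h k‖ : ℂ)) ^ 2 = ∑ y ∈ range n, h y * (lsiC n h k * (starRingEnd ℂ) (lsiW n ^ (k * y))) := by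
      intro k _
      rw [← Complex.mul_conj']
      conv_lhs => rw [show (starRingEnd ℂ) (lsiC n h k) = ∑ y ∈ range n, (h y : ℂ) * (starRingEnd ℂ) (lsiW n ^ (k * y)) by
        unfold lsiC; simp]
      rw [mul_sum]
      exact sum_congr rfl (fun y _ => by ring)
    rw [sum_congr rfl this, sum_comm, mul_sum]
    refine sum_congr rfl (fun y hy => ?_)
    rw [← mul_sum, lsi_inversion n hn h y (mem_range.1 hy)]; ring
  exact_mod_cast h1

open Finset in
lemma lsi_shift_sum {M : Type*} [AddCommGroup M] (n : ℕ) (g : ℕ → M) (hg : g n = g 0) :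
    ∑ x ∈ range n, g (x + 1) = ∑ x ∈ range n, g x := by
  have h1 := sum_range_succ g n
  have h2 := sum_range_succ' g n
  rw [h1, hg] at h2
  exact (add_right_cancel h2).symm

open Finset in
lemma lsi_diff_norm (n : ℕ) (hn : n ≠ 0) (h : ℕ → ℝ) (hper : h n = h 0) (k : ℕ) :
    ‖lsiC n (fun x => h (x + 1) - h x) k‖ ^ 2 = 2 * (1 - Real.cos (2 * Real.pi / n * k)) * ‖lsiC n h k‖ ^ 2 := by
  have h1 : lsiC n (fun x => h (x + 1) - h x) k * lsiW n ^ k = lsiC n h k * (1 - lsiW n ^ k) := by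
    have h2 : ∑ x ∈ range n, (h (x+1) : ℂ) * lsiW n ^ (k * (x+1)) = lsiC n h k := by
      unfold lsiC
      apply lsi_shift_sum n (fun x => (h x : ℂ) * lsiW n ^ (k * x))
      simp only [hper, mul_zero, pow_zero]
      rw [mul_comm k n, pow_mul, (lsiW_prim n hn).pow_eq_one, one_pow]
    have h3 : lsiC n (fun x => h (x + 1) - h x) k * lsiW n ^ k
        = ∑ x ∈ range n, (h (x+1) : ℂ) * lsiW n ^ (k * (x+1)) - lsiC n h k * lsiW n ^ k := by
      unfold lsiC
      rw [sum_mul, sum_mul, ← sum_sub_distrib]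
      refine sum_congr rfl (fun x _ => ?_)
      rw [show k * (x+1) = k * x + k by ring, pow_add]
      push_cast; ring
    rw [h3, h2]; ring
  have h4 : ‖lsiC n (fun x => h (x + 1) - h x) k‖ = ‖lsiC n h k‖ * ‖1 - lsiW n ^ k‖ := by
    have := congrArg norm h1
    rwa [norm_mul, norm_mul, lsiW_norm, mul_one] at this
  have h5 : ‖1 - lsiW n ^ k‖ ^ 2 = 2 * (1 - Real.cos (2 * Real.pi / n * k)) := by
    rw [← Complex.normSq_eq_norm_sq, Complex.normSq_apply]
    simp only [Complex.sub_re, Complex.one_re, Complex.sub_im, Complex.one_im, lsiW_re, lsiW_im]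
    nlinarith [Real.sin_sq_add_cos_sq (2 * Real.pi / n * k)]
  rw [h4, mul_pow, h5]; ring

lemma lsi_cos_diff (a b : ℝ) : Real.cos a - Real.cos b = 2 * (Real.sin ((b - a)/2) * Real.sin ((b + a)/2)) := by
  rw [Real.cos_sub_cos, show (a - b)/2 = -((b-a)/2) by ring, Real.sin_neg, add_comm a b]; ring

open Finset in
lemma lsi_telescope (n : ℕ) (t : ℝ) (ht : t = Real.pi / n) (J : ℕ) (hJ : J + 3 ≤ n) :
    ∑ j ∈ range J, Real.sin (2*t) / (Real.sin ((j+1 : ℝ)*t) * Real.sin ((j+3 : ℝ)*t))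
      = Real.cos t / Real.sin t + Real.cos (2*t) / Real.sin (2*t)
        - Real.cos ((J+1 : ℝ)*t) / Real.sin ((J+1 : ℝ)*t) - Real.cos ((J+2 : ℝ)*t) / Real.sin ((J+2 : ℝ)*t) := by
  have hn : (0:ℝ) < n := by exact_mod_cast (by omega : 0 < n)
  have ht0 : 0 < t := by rw [ht]; exact div_pos Real.pi_pos hn
  have hs : ∀ k : ℕ, 0 < k → k < n → 0 < Real.sin (k * t) := by
    intro k h0 h1
    apply Real.sin_pos_of_pos_of_lt_pi
    · exact mul_pos (by exact_mod_cast h0) ht0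
    · have : (k:ℝ) < n := by exact_mod_cast h1
      calc k * t < n * t := by gcongr
        _ = Real.pi := by rw [ht]; field_simp
  induction J with
  | zero => simp
  | succ J ih =>
    rw [sum_range_succ, ih (by omega)]
    have h1 := hs (J+1) (by omega) (by omega)
    have h3 := hs (J+3) (by omega) (by omega)
    push_cast at h1 h3 ⊢
    have e1 : Real.sin (2*t) = Real.sin ((J+3:ℝ)*t) * Real.cos ((J+1:ℝ)*t) - Real.cos ((J+3:ℝ)*t) * Real.sin ((J+1:ℝ)*t) := by
      rw [← Real.sin_sub]; congr 1; ring
    have e2 : Real.sin (2*t) / (Real.sin ((J+1 : ℝ)*t) * Real.sin ((J+3 : ℝ)*t)) = Real.cos ((J+1:ℝ)*t) / Real.sin ((J+1:ℝ)*t) - Real.cos ((J+3:ℝ)*t) / Real.sin ((J+3:ℝ)*t) := by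
      have hg : ∀ s1 s3 c1 c3 : ℝ, s1 ≠ 0 → s3 ≠ 0 → (s3*c1 - c3*s1)/(s1*s3) = c1/s1 - c3/s3 := by
        intro s1 s3 c1 c3 a b; field_simp
      rw [e1]; exact hg _ _ _ _ h1.ne' h3.ne'
    rw [e2, show (J + 1 + 1 : ℝ) = J + 2 by ring, show (J + 1 + 2 : ℝ) = J + 3 by ring]
    ring

open Finset in
lemma lsi_green (N : ℕ) (hN : 2 ≤ N) (q : ℝ) (hq : q = Real.cos (2 * Real.pi / (N+3 : ℕ))) :
    ∑ j ∈ range N, (1 - q) / (q - Real.cos (2 * Real.pi / (N+3 : ℕ) * (j + 2 : ℕ))) = (1 + 2*q)/(1 + q) := by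
  obtain ⟨t, ht⟩ : ∃ t, t = Real.pi / (N+3 : ℕ) := ⟨_, rfl⟩
  have htel := lsi_telescope (N+3) t ht N le_rfl
  have hn : (0:ℝ) < (N+3 : ℕ) := by positivity
  have ht0 : 0 < t := by rw [ht]; exact div_pos Real.pi_pos hn
  have hnt : (N+3 : ℕ) * t = Real.pi := by rw [ht]; field_simp
  have hn5 : (5:ℝ) ≤ (N+3 : ℕ) := by exact_mod_cast (by omega : 5 ≤ N+3)
  have ht5 : 5 * t ≤ Real.pi := by rw [← hnt]; gcongr
  have hs1 : 0 < Real.sin t := Real.sin_pos_of_pos_of_lt_pi ht0 (by linarith)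
  have hs2 : 0 < Real.sin (2*t) := Real.sin_pos_of_pos_of_lt_pi (by linarith) (by linarith)
  have hc1 : 0 < Real.cos t := Real.cos_pos_of_mem_Ioo ⟨by linarith, by linarith⟩
  have hq2 : q = Real.cos (2*t) := by rw [hq, ht]; congr 1; ring
  have hterm : ∀ j ∈ range N, (1 - q) / (q - Real.cos (2 * Real.pi / (N+3 : ℕ) * (j + 2 : ℕ)))
      = (Real.sin t ^ 2 / Real.sin (2*t)) * (Real.sin (2*t) / (Real.sin ((j+1 : ℝ)*t) * Real.sin ((j+3 : ℝ)*t))) := by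
    intro j _
    have e1 : 1 - q = 2 * Real.sin t ^ 2 := by rw [hq2, Real.cos_two_mul]; nlinarith [Real.sin_sq_add_cos_sq t]
    have e2 : q - Real.cos (2 * Real.pi / (N+3 : ℕ) * (j + 2 : ℕ)) = 2 * (Real.sin ((j+1 : ℝ)*t) * Real.sin ((j+3 : ℝ)*t)) := by
      rw [hq2, show 2 * Real.pi / (N+3 : ℕ) * (j + 2 : ℕ) = 2 * (j+2) * t by rw [ht]; push_cast; ring, lsi_cos_diff]
      congr 3 <;> ring
    rw [e1, e2, mul_div_mul_left _ _ two_ne_zero]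
    have hg : ∀ a b c : ℝ, b ≠ 0 → a/c = a/b*(b/c) := by
      intro a b c hb; field_simp
    exact hg _ _ _ hs2.ne'
  rw [sum_congr rfl hterm, ← mul_sum, htel]
  have e3 : (N+1:ℝ)*t = Real.pi - 2*t := by rw [← hnt]; push_cast; ring
  have e4 : (N+2:ℝ)*t = Real.pi - t := by rw [← hnt]; push_cast; ring
  rw [e3, e4, Real.cos_pi_sub, Real.sin_pi_sub, Real.cos_pi_sub, Real.sin_pi_sub, hq2]
  have h2 : Real.sin (2*t) = 2 * Real.sin t * Real.cos t := Real.sin_two_mul t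
  have h3 : Real.cos (2*t) = 2 * Real.cos t ^ 2 - 1 := Real.cos_two_mul t
  rw [h2, h3]
  have h4 : 1 + (2 * Real.cos t ^ 2 - 1) ≠ 0 := by
    have : 0 < Real.cos t ^ 2 := by positivity
    linarith
  field_simp
  ring
open Finset in
lemma lsi_split {M : Type*} [AddCommMonoid M] (N : ℕ) (F : ℕ → M) :
    ∑ k ∈ range (N+3), F k = ∑ j ∈ range N, F (j+2) + F 1 + F 0 + F (N+2) := by
  rw [sum_range_succ, sum_range_succ', sum_range_succ']

lemma lsi_cos_le (N : ℕ) (hN : 2 ≤ N) (j : ℕ) (hj : j < N) :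
    Real.cos (2 * Real.pi / (N+3 : ℕ) * (j + 2 : ℕ)) ≤ Real.cos (2 * (2 * Real.pi / (N+3 : ℕ))) := by
  have hn : (0:ℝ) < (N+3 : ℕ) := by positivity
  obtain ⟨t, ht⟩ : ∃ t, t = 2 * Real.pi / (N+3 : ℕ) := ⟨_, rfl⟩
  have ht0 : 0 < t := by rw [ht]; exact div_pos (by linarith [Real.pi_pos]) hn
  have hnt : (N+3 : ℕ) * t = 2 * Real.pi := by rw [ht]; field_simp
  rw [← ht]
  have hj' : ((j:ℕ):ℝ) + 1 ≤ N := by exact_mod_cast hj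
  have h0 : (0:ℝ) ≤ j := by positivity
  push_cast at hnt ⊢
  rcases le_total (t * (j + 2)) Real.pi with h | h
  · apply Real.cos_le_cos_of_nonneg_of_le_pi (by positivity) h
    nlinarith
  · rw [← Real.cos_two_pi_sub]
    apply Real.cos_le_cos_of_nonneg_of_le_pi (by positivity) (by linarith)
    nlinarith

open Finset in
lemma lsi_spectral (N : ℕ) (hN : 2 ≤ N) (h : ℕ → ℝ) (hper : h (N+3) = h 0)
    (hsum : ∑ x ∈ range (N+3), h x = 0) (θ q Cc Ss D : ℝ) (hθ : θ = 2 * Real.pi / (N+3 : ℕ))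
    (hq : q = Real.cos θ)
    (hCc : Cc = ∑ x ∈ range (N+3), h x * Real.cos (θ * x))
    (hSs : Ss = ∑ x ∈ range (N+3), h x * Real.sin (θ * x))
    (hD : D = (∑ x ∈ range (N+3), (h (x+1) - h x)^2) / (2 * (1 - q)) - ∑ x ∈ range (N+3), h x ^ 2) :
    (1 + 2*q) * (∑ x ∈ range (N+3), h x ^ 2 - 2 / (N+3 : ℕ) * (Cc^2 + Ss^2)) ≤ D ∧
    ∀ y < N+3, (h y - 2 / (N+3 : ℕ) * (Cc * Real.cos (θ * y) + Ss * Real.sin (θ * y)))^2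
      ≤ (1 + 2*q)/(1+q) * D / (N+3 : ℕ) := by
  have hn : (0:ℝ) < (N+3 : ℕ) := by positivity
  have ht0 : 0 < θ := by rw [hθ]; exact div_pos (by linarith [Real.pi_pos]) hn
  have hnt : (N+3 : ℕ) * θ = 2 * Real.pi := by rw [hθ]; field_simp
  have hn5 : (5:ℝ) ≤ (N+3 : ℕ) := by exact_mod_cast (by omega : 5 ≤ N+3)
  have ht5 : 5 * θ ≤ 2 * Real.pi := by rw [← hnt]; gcongr
  have hq0 : 0 < q := by
    rw [hq]; exact Real.cos_pos_of_mem_Ioo ⟨by linarith, by linarith⟩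
  have hq1 : q < 1 := by
    rw [hq, ← Real.cos_zero]
    exact Real.cos_lt_cos_of_nonneg_of_le_pi le_rfl (by linarith) ht0
  have hne : N + 3 ≠ 0 := by omega
  obtain ⟨c, hc⟩ : ∃ c, c = lsiC (N+3) h := ⟨_, rfl⟩
  have hc0 : c 0 = 0 := by
    rw [hc]; unfold lsiC; simp only [zero_mul, pow_zero, mul_one]
    exact_mod_cast hsum
  have hre : (c 1).re = Cc := by
    rw [hc, hCc]; unfold lsiC; rw [Complex.re_sum]
    refine sum_congr rfl (fun x _ => ?_)
    rw [Complex.re_ofReal_mul, one_mul, lsiW_re, hθ]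
  have him : (c 1).im = Ss := by
    rw [hc, hSs]; unfold lsiC; rw [Complex.im_sum]
    refine sum_congr rfl (fun x _ => ?_)
    rw [Complex.im_ofReal_mul, one_mul, lsiW_im, hθ]
  have hwl : ∀ x, lsiW (N+3) ^ ((N+2) * x) = (starRingEnd ℂ) (lsiW (N+3) ^ x) := by
    intro x
    rw [lsiW_conj]
    apply eq_inv_of_mul_eq_one_left
    rw [← pow_add, show (N+2)*x + x = (N+3)*x by ring, pow_mul, (lsiW_prim (N+3) hne).pow_eq_one, one_pow]
  have hcl : c (N+2) = (starRingEnd ℂ) (c 1) := by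
    rw [hc]; unfold lsiC; rw [map_sum]
    refine sum_congr rfl (fun x _ => ?_)
    rw [hwl, map_mul, Complex.conj_ofReal, one_mul]
  have hnl : ‖c (N+2)‖ = ‖c 1‖ := by rw [hcl, Complex.norm_conj]
  have hn1 : ‖c 1‖^2 = Cc^2 + Ss^2 := by
    rw [← Complex.normSq_eq_norm_sq, Complex.normSq_apply, hre, him]; ring
  have hcosl : Real.cos (2 * Real.pi / (N+3 : ℕ) * (N+2 : ℕ)) = q := by
    rw [hq, ← Real.cos_two_pi_sub, ← hθ]; congr 1; rw [← hnt]; push_cast; ring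
  have hcos1 : Real.cos (2 * Real.pi / (N+3 : ℕ) * (1 : ℕ)) = q := by
    rw [hq, hθ]; simp
  have P := lsi_parseval (N+3) hne h
  have P' := lsi_parseval (N+3) hne (fun x => h (x+1) - h x)
  simp_rw [lsi_diff_norm (N+3) hne h hper] at P'
  rw [lsi_split, ← hc, hc0, hnl, hn1] at P
  rw [lsi_split, ← hc, hc0, hnl, hn1, hcosl, hcos1] at P'
  simp only [norm_zero] at P P'
  obtain ⟨μ, hμ⟩ : ∃ μ : ℕ → ℝ, ∀ j, μ j = (q - Real.cos (2 * Real.pi / (N+3 : ℕ) * (j + 2 : ℕ))) / (1 - q) :=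
    ⟨_, fun _ => rfl⟩
  have hμge : ∀ j < N, 1 + 2*q ≤ μ j := by
    intro j hj
    rw [hμ, le_div_iff₀ (by linarith)]
    have := lsi_cos_le N hN j hj
    rw [← hθ, Real.cos_two_mul, ← hq] at this
    rw [← hθ]; nlinarith
  have hDμ : (N+3 : ℕ) * D = ∑ j ∈ range N, μ j * ‖c (j+2)‖^2 := by
    have e : ∑ j ∈ range N, μ j * ‖c (j+2)‖^2
      = (∑ j ∈ range N, 2 * (1 - Real.cos (2 * Real.pi / (N+3 : ℕ) * (j+2 : ℕ))) * ‖c (j+2)‖^2) / (2 * (1-q))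
        - ∑ j ∈ range N, ‖c (j+2)‖^2 := by
      rw [sum_div, ← sum_sub_distrib]
      refine sum_congr rfl (fun j _ => ?_)
      rw [hμ]
      have : 1 - q ≠ 0 := by linarith
      field_simp; ring
    rw [e, hD]
    have h1 : ∑ j ∈ range N, ‖c (j+2)‖^2 = (N+3 : ℕ) * ∑ x ∈ range (N+3), h x ^ 2 - 2 * (Cc^2+Ss^2) := by
      linarith
    rw [h1]
    have h2 : ∑ j ∈ range N, 2 * (1 - Real.cos (2 * Real.pi / (N+3 : ℕ) * (j+2 : ℕ))) * ‖c (j+2)‖^2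
      = (N+3 : ℕ) * ∑ x ∈ range (N+3), (h (x+1) - h x) ^ 2 - 4 * (1-q) * (Cc^2+Ss^2) := by
      linarith
    rw [h2]
    have : 1 - q ≠ 0 := by linarith
    field_simp; ring
  constructor
  · have h1 : (N+3 : ℕ) * ((1 + 2*q) * (∑ x ∈ range (N+3), h x ^ 2 - 2 / (N+3 : ℕ) * (Cc^2 + Ss^2)))
        = ∑ j ∈ range N, (1+2*q) * ‖c (j+2)‖^2 := by
      rw [← mul_sum]
      have h1 : ∑ j ∈ range N, ‖c (j+2)‖^2 = (N+3 : ℕ) * ∑ x ∈ range (N+3), h x ^ 2 - 2 * (Cc^2+Ss^2) := by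
        linarith
      rw [h1]; field_simp
    apply le_of_mul_le_mul_left _ hn
    rw [h1, hDμ]
    exact sum_le_sum (fun j hj => mul_le_mul_of_nonneg_right (hμge j (mem_range.1 hj)) (by positivity))
  · intro y hy
    have I := lsi_inversion (N+3) hne h y hy
    rw [lsi_split, ← hc, hc0, hcl, hwl] at I
    have hr := congrArg Complex.re I
    have e1 : ((starRingEnd ℂ) (c 1) * (starRingEnd ℂ) ((starRingEnd ℂ) (lsiW (N+3) ^ y))).re
        = Cc * Real.cos (θ * y) + Ss * Real.sin (θ * y) := by
      rw [← map_mul, Complex.conj_re, Complex.mul_re, Complex.conj_re, Complex.conj_im, hre, him, lsiW_re, lsiW_im, hθ]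
      ring
    have e2 : (c 1 * (starRingEnd ℂ) (lsiW (N+3) ^ (1 * y))).re
        = Cc * Real.cos (θ * y) + Ss * Real.sin (θ * y) := by
      rw [one_mul, Complex.mul_re, Complex.conj_re, Complex.conj_im, hre, him, lsiW_re, lsiW_im, hθ]
      ring
    rw [Complex.add_re, Complex.add_re, Complex.add_re, e1, e2, zero_mul, Complex.zero_re,
      ← Complex.ofReal_natCast, ← Complex.ofReal_mul, Complex.ofReal_re] at hr
    obtain ⟨S, hS⟩ : ∃ S, S = ∑ j ∈ range N, c (j+2) * (starRingEnd ℂ) (lsiW (N+3) ^ ((j+2) * y)) := ⟨_, rfl⟩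
    rw [← hS] at hr
    have hSn : |S.re| ≤ ∑ j ∈ range N, ‖c (j+2)‖ := by
      refine (Complex.abs_re_le_norm S).trans ?_
      rw [hS]
      refine (norm_sum_le _ _).trans (le_of_eq (sum_congr rfl (fun j _ => ?_)))
      rw [norm_mul, Complex.norm_conj, lsiW_norm, mul_one]
    have hG := lsi_green N hN q (by rw [hq, hθ])
    have hCS : (∑ j ∈ range N, ‖c (j+2)‖)^2 ≤ (1+2*q)/(1+q) * ((N+3 : ℕ) * D) := by
      rw [hDμ, ← hG]
      apply sum_sq_le_sum_mul_sum_of_sq_le_mul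
      · intro j hj
        have h1 := hμge j (mem_range.1 hj)
        have h2 := hμ j
        rw [← one_div_div, ← h2]
        have : 0 < μ j := by linarith
        positivity
      · intro j hj
        have h1 := hμge j (mem_range.1 hj)
        have : 0 < μ j := by linarith
        positivity
      · intro j hj
        have h1 := hμge j (mem_range.1 hj)
        have h2 := hμ j
        have : 0 < μ j := by linarith
        rw [← one_div_div, ← h2]
        apply le_of_eq
        field_simp
    have hSS : S.re^2 ≤ (1+2*q)/(1+q) * ((N+3 : ℕ) * D) := by
      refine le_trans ?_ hCS
      rw [← sq_abs]
      gcongr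
    have e3 : h y - 2 / (N+3 : ℕ) * (Cc * Real.cos (θ * y) + Ss * Real.sin (θ * y)) = S.re / (N+3 : ℕ) := by
      field_simp; linarith
    rw [e3, div_pow, div_le_iff₀ (by positivity)]
    refine hSS.trans (le_of_eq ?_)
    field_simp
open Finset in
lemma lsi_trig (n j : ℕ) (hn : n ≠ 0) (hj : ¬ n ∣ j) (φ : ℝ) :
    lsiE n (fun x => Real.cos (j * (2 * Real.pi / n * x + φ))) = 0 := by
  have h1 : ∑ x ∈ range n, (lsiW n ^ j) ^ x = 0 := by
    apply lsi_geom
    · rw [← pow_mul, mul_comm, pow_mul, (lsiW_prim n hn).pow_eq_one, one_pow]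
    · intro h
      exact hj ((lsiW_prim n hn).dvd_of_pow_eq_one j h)
  have h2 : ∀ x : ℕ, Real.cos (j * (2 * Real.pi / n * x + φ))
      = ((lsiW n ^ j) ^ x * Complex.exp ((j * φ : ℝ) * Complex.I)).re := by
    intro x
    rw [← pow_mul, lsiW_pow, ← Complex.exp_add, ← add_mul, ← Complex.ofReal_add, Complex.exp_ofReal_mul_I_re]
    congr 1; push_cast; ring
  unfold lsiE
  rw [← sum_div]
  simp_rw [h2]
  rw [← Complex.re_sum, ← sum_mul, h1]; simp

lemma lsi_cos_five : 0 < Real.cos (2 * Real.pi / 5) ∧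
    4 * Real.cos (2 * Real.pi / 5)^2 + 2 * Real.cos (2 * Real.pi / 5) - 1 = 0 := by
  have h5 : Real.sqrt 5 ^ 2 = 5 := Real.sq_sqrt (by norm_num)
  have e : Real.cos (2 * Real.pi / 5) = (Real.sqrt 5 - 1)/4 := by
    rw [show 2 * Real.pi / 5 = 2 * (Real.pi/5) by ring, Real.cos_two_mul, Real.cos_pi_div_five]
    nlinarith
  constructor
  · exact Real.cos_pos_of_mem_Ioo ⟨by linarith [Real.pi_pos], by linarith [Real.pi_pos]⟩
  · rw [e]; nlinarith

open Finset in
set_option maxHeartbeats 1000000 in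
lemma lsi_ge5 (N : ℕ) (hN : 2 ≤ N) (h : ℕ → ℝ) (hper : h (N+3) = h 0)
    (hh : lsiE (N+3) (fun x => h x) = 0) (hh1 : ∀ x < N+3, -1 ≤ h x) (q m D Φ : ℝ)
    (hq : q = Real.cos (2 * Real.pi / (N+3 : ℕ)))
    (hm : lsiE (N+3) (fun x => h x ^ 2) = m)
    (hD : D = lsiE (N+3) (fun x => (h (x+1) - h x)^2) / (2 * (1 - q)) - m)
    (hΦ : 3 * m^2/(6+2*m) ≤ Φ) :
    lsiE (N+3) (fun x => h x ^ 3) ≤ 3 * D + 3/2 * Φ := by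
  have hn : (0:ℝ) < (N+3 : ℕ) := by positivity
  obtain ⟨θ, hθ⟩ : ∃ θ, θ = 2 * Real.pi / (N+3 : ℕ) := ⟨_, rfl⟩
  have ht0 : 0 < θ := by rw [hθ]; exact div_pos (by linarith [Real.pi_pos]) hn
  have hnt : (N+3 : ℕ) * θ = 2 * Real.pi := by rw [hθ]; field_simp
  have hn5 : (5:ℝ) ≤ (N+3 : ℕ) := by exact_mod_cast (by omega : 5 ≤ N+3)
  have ht5 : 5 * θ ≤ 2 * Real.pi := by rw [← hnt]; gcongr
  rw [← hθ] at hq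
  obtain ⟨hc0, hc5⟩ := lsi_cos_five
  have hqge : Real.cos (2 * Real.pi / 5) ≤ q := by
    rw [hq]
    exact Real.cos_le_cos_of_nonneg_of_le_pi ht0.le (by linarith [Real.pi_pos]) (by linarith)
  have hq0 : 0 < q := by linarith
  have hqq : 0 ≤ 4 * q^2 + 2*q - 1 := by nlinarith
  have hq1 : q < 1 := by
    rw [hq, ← Real.cos_zero]
    exact Real.cos_lt_cos_of_nonneg_of_le_pi le_rfl (by linarith) ht0
  have hq4 : 1/4 ≤ q := by nlinarith
  have hE1 : lsiE (N+3) (fun _ => 1) = 1 := by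
    unfold lsiE; simp; field_simp
  obtain ⟨Cc, hCc⟩ : ∃ Cc, Cc = ∑ x ∈ range (N+3), h x * Real.cos (θ * x) := ⟨_, rfl⟩
  obtain ⟨Ss, hSs⟩ : ∃ Ss, Ss = ∑ x ∈ range (N+3), h x * Real.sin (θ * x) := ⟨_, rfl⟩
  have hsum : ∑ x ∈ range (N+3), h x = 0 := by
    unfold lsiE at hh; rw [← sum_div] at hh
    exact (div_eq_zero_iff.1 hh).resolve_right hn.ne'
  have hm' : ∑ x ∈ range (N+3), h x ^ 2 = (N+3 : ℕ) * m := by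
    rw [← hm]; unfold lsiE; rw [← sum_div]; field_simp
  have hd' : ∑ x ∈ range (N+3), (h (x+1) - h x) ^ 2 = (N+3 : ℕ) * lsiE (N+3) (fun x => (h (x+1) - h x)^2) := by
    unfold lsiE; rw [← sum_div]; field_simp
  obtain ⟨S1, S2⟩ := lsi_spectral N hN h hper hsum θ q Cc Ss ((N+3 : ℕ) * D) hθ hq hCc hSs (by
    rw [hD, hm', hd']; ring)
  rw [hm'] at S1
  obtain ⟨z, hz⟩ : ∃ z : ℂ, z = ⟨2/(N+3:ℕ) * Cc, - (2/(N+3:ℕ) * Ss)⟩ := ⟨_, rfl⟩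
  have zc : ‖z‖ * Real.cos z.arg = 2/(N+3:ℕ) * Cc := by rw [Complex.norm_mul_cos_arg, hz]
  have zs : ‖z‖ * Real.sin z.arg = - (2/(N+3:ℕ) * Ss) := by rw [Complex.norm_mul_sin_arg, hz]
  have hA0 : 0 ≤ ‖z‖ := norm_nonneg z
  obtain ⟨A, hA⟩ : ∃ A, A = ‖z‖ := ⟨_, rfl⟩
  obtain ⟨φ, hφ⟩ : ∃ φ, φ = z.arg := ⟨_, rfl⟩
  rw [← hA] at zc zs hA0
  rw [← hφ] at zc zs
  have hCcA : Cc = (N+3:ℕ)/2 * (A * Real.cos φ) := by rw [zc]; field_simp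
  have hSsA : Ss = - ((N+3:ℕ)/2 * (A * Real.sin φ)) := by rw [zs]; field_simp
  have hA2 : Cc^2 + Ss^2 = ((N+3:ℕ)/2)^2 * A^2 := by
    rw [hCcA, hSsA]
    linear_combination ((N+3:ℕ)/2)^2 * A^2 * Real.sin_sq_add_cos_sq φ
  have S1' : (1+2*q) * (m - A^2/2) ≤ D := by
    rw [hA2] at S1
    apply le_of_mul_le_mul_left _ hn
    refine le_trans (le_of_eq ?_) S1
    field_simp
  obtain ⟨p, hp⟩ : ∃ p : ℕ → ℝ, ∀ x, p x = Real.cos (θ * x + φ) := ⟨_, fun _ => rfl⟩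
  have hAp : ∀ x, A * p x = 2/(N+3:ℕ) * (Cc * Real.cos (θ * x) + Ss * Real.sin (θ * x)) := by
    intro x
    rw [hp, Real.cos_add]
    linear_combination Real.cos (θ * x) * zc - Real.sin (θ * x) * zs
  have hhp : lsiE (N+3) (fun x => h x * p x) = A/2 := by
    have : lsiE (N+3) (fun x => h x * p x) = (Real.cos φ / (N+3:ℕ)) * Cc - (Real.sin φ / (N+3:ℕ)) * Ss := by
      rw [hCc, hSs]
      simp only [lsiE, mul_sum, ← sum_sub_distrib]
      refine sum_congr rfl (fun x _ => ?_)
      rw [hp, Real.cos_add]; ring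
    rw [this, hCcA, hSsA]
    field_simp
    linear_combination A * Real.sin_sq_add_cos_sq φ
  have htr : ∀ j : ℕ, 0 < j → j < 5 → lsiE (N+3) (fun x => Real.cos (j * (θ * x + φ))) = 0 := by
    intro j h0 h5
    rw [hθ]
    exact lsi_trig (N+3) j (by omega) (Nat.not_dvd_of_pos_of_lt h0 (by omega)) φ
  have t1 := htr 1 (by norm_num) (by norm_num)
  have t2 := htr 2 (by norm_num) (by norm_num)
  have t3 := htr 3 (by norm_num) (by norm_num)
  have t4 := htr 4 (by norm_num) (by norm_num)
  have hp1 : lsiE (N+3) (fun x => p x) = 0 := by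
    rw [← t1]; congr 1; funext x; rw [hp]; simp
  have hp2 : lsiE (N+3) (fun x => p x ^ 2) = 1/2 := by
    have : lsiE (N+3) (fun x => Real.cos ((2:ℕ) * (θ * x + φ))) = 2 * lsiE (N+3) (fun x => p x ^ 2) - lsiE (N+3) (fun _ => 1) := by
      simp only [lsiE, mul_sum, ← sum_sub_distrib]
      refine sum_congr rfl (fun x _ => ?_)
      rw [Nat.cast_ofNat, Real.cos_two_mul, ← hp]; ring
    rw [this, hE1] at t2; linarith
  have hp3 : lsiE (N+3) (fun x => p x ^ 3) = 0 := by
    have : lsiE (N+3) (fun x => Real.cos ((3:ℕ) * (θ * x + φ))) = 4 * lsiE (N+3) (fun x => p x ^ 3) - 3 * lsiE (N+3) (fun x => p x) := by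
      simp only [lsiE, mul_sum, ← sum_sub_distrib]
      refine sum_congr rfl (fun x _ => ?_)
      rw [Nat.cast_ofNat, Real.cos_three_mul, ← hp]; ring
    rw [this, hp1] at t3; linarith
  have hp4 : lsiE (N+3) (fun x => p x ^ 4) = 3/8 := by
    have : lsiE (N+3) (fun x => Real.cos ((4:ℕ) * (θ * x + φ))) = 8 * lsiE (N+3) (fun x => p x ^ 4) - 8 * lsiE (N+3) (fun x => p x ^ 2) + lsiE (N+3) (fun _ => 1) := by
      simp only [lsiE, mul_sum, ← sum_sub_distrib, ← sum_add_distrib]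
      refine sum_congr rfl (fun x _ => ?_)
      rw [Nat.cast_ofNat, show (4:ℝ) * (θ * x + φ) = 2 * (2 * (θ * x + φ)) by ring, Real.cos_two_mul, Real.cos_two_mul, ← hp]; ring
    rw [this, hE1, hp2] at t4; linarith
  have hρ : 0 ≤ m - A^2/2 := by
    have hρ0 : lsiE (N+3) (fun x => (h x - A * p x)^2) = m - A^2/2 := by
      have : lsiE (N+3) (fun x => (h x - A * p x)^2) = lsiE (N+3) (fun x => h x ^ 2) - (2*A) * lsiE (N+3) (fun x => h x * p x)
          + A^2 * lsiE (N+3) (fun x => p x ^ 2) := by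
        simp only [lsiE, mul_sum, ← sum_add_distrib, ← sum_sub_distrib]
        exact sum_congr rfl (fun x _ => by ring)
      rw [this, hm, hhp, hp2]; ring
    rw [← hρ0]; exact lsiE_nonneg _ _ (fun x _ => by positivity)
  have hD0 : 0 ≤ D := le_trans (mul_nonneg (by linarith) hρ) S1'
  obtain ⟨κ, hκ⟩ : ∃ κ, κ = (1+2*q)/(1+q) := ⟨_, rfl⟩
  have hκ0 : 0 ≤ κ := by rw [hκ]; positivity
  have hκq : κ * (1+q) = 1 + 2*q := by rw [hκ]; field_simp
  have hκD : 0 ≤ κ * D := by positivity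
  have hR2 : Real.sqrt (κ * D) ^ 2 = κ * D := Real.sq_sqrt hκD
  refine lsi_abstract (N+3) h p A (Real.sqrt (κ * D)) D Φ m hE1 hp1 hp2 hp3 hp4 (fun x => by rw [hp]; exact Real.cos_le_one _)
    hh hm hhp hA0 (Real.sqrt_nonneg _) hh1 ?_ ?_ ?_ hΦ
  · intro x hx
    apply Real.le_sqrt_of_sq_le
    rw [hAp]
    refine (S2 x hx).trans (le_of_eq ?_)
    rw [hκ]; field_simp
  · rw [hR2, hκ]
    obtain ⟨w, hw⟩ : ∃ w, w = m - A^2/2 := ⟨_, rfl⟩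
    rw [← hw] at S1' hρ ⊢
    have h1 : w ≤ D / (1+2*q) := by rw [le_div_iff₀ (by linarith)]; linarith
    have h2 : 5/9 * ((1+2*q)/(1+q)) + 1/(1+2*q)/2 ≤ 1 := by
      rw [show 5/9 * ((1+2*q)/(1+q)) + 1/(1+2*q)/2 = (10 * (1+2*q)^2 + 9 * (1+q))/(18 * (1+q)*(1+2*q)) by field_simp; ring,
        div_le_one (by positivity)]
      nlinarith
    have h3 := mul_le_mul_of_nonneg_right h2 hD0
    have h4 : (5/9 * ((1+2*q)/(1+q)) + 1/(1+2*q)/2) * D = 5/9 * ((1+2*q)/(1+q) * D) + (D/(1+2*q))/2 := by ring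
    linarith
  · rw [hR2]
    have h1 : 2 ≤ κ * (1+2*q) := by
      rw [hκ, div_mul_eq_mul_div, le_div_iff₀ (by linarith)]; nlinarith
    have h2 := mul_le_mul_of_nonneg_left S1' hκ0
    have h3 := mul_le_mul_of_nonneg_right h1 hρ
    rw [mul_assoc] at h3
    exact h3.trans h2
lemma lsi_mono (s m : ℝ) (hs : 0 ≤ s) (hsm : s ≤ m) : 3*s^2/(6+2*s) ≤ 3*m^2/(6+2*m) := by
  rw [div_le_div_iff₀ (by linarith) (by linarith)]
  have h1 : s^2 ≤ m^2 := by gcongr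
  have h2 : s*m*s ≤ s*m*m := mul_le_mul_of_nonneg_left hsm (mul_nonneg hs (hs.trans hsm))
  nlinarith

open Finset in
lemma lsi_eq4 (h : ℕ → ℝ) (hper : h 4 = h 0)
    (hh : lsiE 4 (fun x => h x) = 0) (hh1 : ∀ x < 4, -1 ≤ h x) (q m D Φ : ℝ)
    (hq : q = Real.cos (2 * Real.pi / (4 : ℕ)))
    (hm : lsiE 4 (fun x => h x ^ 2) = m)
    (hD : D = lsiE 4 (fun x => (h (x+1) - h x)^2) / (2 * (1 - q)) - m)
    (hΦ : 3 * m^2/(6+2*m) ≤ Φ) :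
    lsiE 4 (fun x => h x ^ 3) ≤ 3 * D + 3/2 * Φ := by
  have hq0 : q = 0 := by
    rw [hq, show 2 * Real.pi / (4:ℕ) = Real.pi/2 by push_cast; ring, Real.cos_pi_div_two]
  have k0 := hh1 0 (by norm_num)
  have k1 := hh1 1 (by norm_num)
  have k2 := hh1 2 (by norm_num)
  have k3 := hh1 3 (by norm_num)
  simp only [lsiE, sum_range_succ, range_zero, sum_empty, Nat.cast_ofNat, zero_add, Nat.reduceAdd, hper, hq0] at hh hm hD ⊢
  generalize h 0 = x0 at *
  generalize h 1 = x1 at *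
  generalize h 2 = x2 at *
  generalize h 3 = x3 at *
  obtain ⟨a, ha⟩ : ∃ a, a = (x0 - x2)/2 := ⟨_, rfl⟩
  obtain ⟨b, hb⟩ : ∃ b, b = (x1 - x3)/2 := ⟨_, rfl⟩
  obtain ⟨r, hr⟩ : ∃ r, r = (x0 - x1 + x2 - x3)/4 := ⟨_, rfl⟩
  have e0 : x0 = r + a := by rw [ha, hr]; linarith
  have e1 : x1 = -r + b := by rw [hb, hr]; linarith
  have e2 : x2 = r - a := by rw [ha, hr]; linarith
  have e3 : x3 = -r - b := by rw [hb, hr]; linarith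
  clear ha hb hr
  subst e0 e1 e2 e3
  have hm' : m = (a^2+b^2)/2 + r^2 := by rw [← hm]; ring
  have hD' : D = r^2 := by rw [hD, hm']; ring
  have ha2 : a^2 ≤ (1+r)^2 := by
    apply sq_le_sq' <;> linarith
  have hb2 : b^2 ≤ (1-r)^2 := by
    apply sq_le_sq' <;> linarith
  have goal' : r * (a^2 - b^2) ≤ 2 * r^2 + Φ := by
    rcases le_total 0 r with h | h
    · have := lsi_four (a^2) r Φ (by positivity) h (by linarith) ha2
        ((lsi_mono _ m (by positivity) (by rw [hm']; nlinarith)).trans hΦ)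
      nlinarith [mul_nonneg h (sq_nonneg b)]
    · have := lsi_four (b^2) (-r) Φ (by positivity) (by linarith) (by linarith) (by rw [← sub_eq_add_neg]; exact hb2)
        ((lsi_mono _ m (by positivity) (by rw [hm']; nlinarith)).trans hΦ)
      nlinarith [mul_nonneg (neg_nonneg.2 h) (sq_nonneg a)]
  rw [hD']
  nlinarith

open Finset in
lemma lsi_core (n : ℕ) (hn : 4 ≤ n) (h : ℕ → ℝ) (hper : h n = h 0)
    (hh : lsiE n (fun x => h x) = 0) (hh1 : ∀ x < n, -1 ≤ h x) (q m D Φ : ℝ)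
    (hq : q = Real.cos (2 * Real.pi / n))
    (hm : lsiE n (fun x => h x ^ 2) = m)
    (hD : D = lsiE n (fun x => (h (x+1) - h x)^2) / (2 * (1 - q)) - m)
    (hΦ : 3 * m^2/(6+2*m) ≤ Φ) :
    lsiE n (fun x => h x ^ 3) ≤ 3 * D + 3/2 * Φ := by
  rcases Nat.lt_or_ge 4 n with h5 | h5
  · obtain ⟨N, rfl⟩ : ∃ N, n = N + 3 := ⟨n - 3, by omega⟩
    exact lsi_ge5 N (by omega) h hper hh hh1 q m D Φ hq hm hD hΦ
  · obtain rfl : n = 4 := by omega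
    exact lsi_eq4 h hper hh hh1 q m D Φ hq hm hD hΦ

open Finset in
lemma lsi_range (n : ℕ) (hn : 4 ≤ n) (F : ℕ → ℝ) (hper : F n = F 0) (hF : ∀ x, 0 ≤ F x) (q : ℝ)
    (hq : q = Real.cos (2 * Real.pi / n)) :
    lsiE n (fun x => F x ^ 2 * Real.log (F x ^ 2)) - lsiE n (fun x => F x ^ 2) * Real.log (lsiE n (fun x => F x ^ 2))
      ≤ lsiE n (fun x => (F (x+1) - F x)^2) / (1 - q) := by
  have hn0 : (0:ℝ) < n := by exact_mod_cast (by omega : 0 < n)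
  have hn4 : (4:ℝ) ≤ n := by exact_mod_cast hn
  have hq1 : q < 1 := by
    rw [hq, ← Real.cos_zero]
    have h0 := Real.pi_pos
    apply Real.cos_lt_cos_of_nonneg_of_le_pi le_rfl _ (by positivity)
    rw [div_le_iff₀ hn0]; nlinarith
  have hE1 : lsiE n (fun _ => 1) = 1 := by
    unfold lsiE; simp; field_simp
  obtain ⟨μ, hμ⟩ : ∃ μ, μ = lsiE n F := ⟨_, rfl⟩
  have hμ0 : 0 ≤ μ := by rw [hμ]; exact lsiE_nonneg _ _ (fun x _ => hF x)
  rcases hμ0.eq_or_lt with h0 | h0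
  · have hz : ∀ x ∈ range n, F x / n = 0 := by
      apply (sum_eq_zero_iff_of_nonneg (fun x _ => div_nonneg (hF x) hn0.le)).1
      rw [h0, hμ]; rfl
    have hz' : ∀ x ∈ range n, F x = 0 := fun x hx => (div_eq_zero_iff.1 (hz x hx)).resolve_right hn0.ne'
    have z1 : lsiE n (fun x => F x ^ 2 * Real.log (F x ^ 2)) = 0 :=
      sum_eq_zero (fun x hx => by simp [hz' x hx])
    have z2 : lsiE n (fun x => F x ^ 2) = 0 :=
      sum_eq_zero (fun x hx => by simp [hz' x hx])
    rw [z1, z2]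
    have := lsiE_nonneg n (fun x => (F (x+1) - F x)^2) (fun x _ => by positivity)
    have h1 : 0 < 1 - q := by linarith
    simp only [zero_mul, sub_zero]
    positivity
  · obtain ⟨h, hh⟩ : ∃ h : ℕ → ℝ, ∀ x, h x = F x / μ - 1 := ⟨_, fun _ => rfl⟩
    have hFh : ∀ x, F x = μ * (1 + h x) := by intro x; rw [hh]; field_simp; ring
    have ht : ∀ x, 0 ≤ 1 + h x := by
      intro x; rw [hh]; have := div_nonneg (hF x) h0.le; linarith
    have hEh : lsiE n (fun x => h x) = 0 := by
      have : μ = μ * lsiE n (fun _ => 1) + μ * lsiE n (fun x => h x) := by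
        conv_lhs => rw [hμ]
        simp only [lsiE, mul_sum, ← sum_add_distrib]
        exact sum_congr rfl (fun x _ => by rw [hFh x]; ring)
      rw [hE1] at this
      have h2 : μ * lsiE n (fun x => h x) = 0 := by linarith
      exact (mul_eq_zero.1 h2).resolve_left h0.ne'
    obtain ⟨m, hm⟩ : ∃ m, lsiE n (fun x => h x ^ 2) = m := ⟨_, rfl⟩
    have hm0 : 0 ≤ m := by rw [← hm]; exact lsiE_nonneg _ _ (fun x _ => by positivity)
    obtain ⟨Q, hQ⟩ : ∃ Q, lsiE n (fun x => (h (x+1) - h x)^2) = Q := ⟨_, rfl⟩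
    have core := lsi_core n hn h (by rw [hh, hh, hper]) hEh (fun x _ => by linarith [ht x]) q m
      (Q / (2 * (1-q)) - m) ((1+m)*Real.log (1+m) - m) hq hm (by rw [hQ]) (lsi_phi_bound m hm0)
    have hF2 : lsiE n (fun x => F x ^ 2) = μ^2 * (1 + m) := by
      have : lsiE n (fun x => F x ^ 2) = μ^2 * lsiE n (fun _ => 1) + (2*μ^2) * lsiE n (fun x => h x) + μ^2 * lsiE n (fun x => h x ^ 2) := by
        simp only [lsiE, mul_sum, ← sum_add_distrib]
        exact sum_congr rfl (fun x _ => by rw [hFh x]; ring)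
      rw [this, hE1, hEh, hm]; ring
    have hdF : lsiE n (fun x => (F (x+1) - F x)^2) = μ^2 * Q := by
      rw [← hQ]
      simp only [lsiE, mul_sum]
      exact sum_congr rfl (fun x _ => by rw [hFh x, hFh (x+1)]; ring)
    obtain ⟨L, hL⟩ : ∃ L, lsiE n (fun x => (1 + h x)^2 * Real.log ((1 + h x)^2)) = L := ⟨_, rfl⟩
    have hFL : lsiE n (fun x => F x ^ 2 * Real.log (F x ^ 2)) = μ^2 * L + Real.log (μ^2) * (μ^2 * (1+m)) := by
      rw [← hL, ← hF2]
      simp only [lsiE, mul_sum, ← sum_add_distrib]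
      refine sum_congr rfl (fun x _ => ?_)
      rw [hFh x]
      rcases (ht x).eq_or_lt with h1 | h1
      · rw [← h1]; simp
      · rw [mul_pow, Real.log_mul (by positivity) (by positivity)]; ring
    have hLle : L ≤ 3 * m + 2/3 * lsiE n (fun x => h x ^ 3) := by
      have : lsiE n (fun x => 2 * h x + 3 * h x ^ 2 + 2/3 * h x ^ 3 - (1 + h x)^2 * Real.log ((1 + h x)^2))
        = 2 * lsiE n (fun x => h x) + 3 * lsiE n (fun x => h x ^ 2) + 2/3 * lsiE n (fun x => h x ^ 3)
          - lsiE n (fun x => (1 + h x)^2 * Real.log ((1 + h x)^2)) := by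
        simp only [lsiE, mul_sum, ← sum_add_distrib, ← sum_sub_distrib]
        exact sum_congr rfl (fun x _ => by ring)
      have h1 := lsiE_nonneg n (fun x => 2 * h x + 3 * h x ^ 2 + 2/3 * h x ^ 3 - (1 + h x)^2 * Real.log ((1 + h x)^2))
        (fun x _ => by
          have := lsi_cubic_bound (1 + h x) (ht x)
          rw [add_sub_cancel_left] at this
          linarith)
      rw [this, hEh, hm, hL] at h1
      linarith
    rw [hFL, hF2, hdF, Real.log_mul (by positivity) (by positivity)]
    have hQ2 : Q / (2 * (1-q)) = (Q / (1-q))/2 := by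
      rw [mul_comm, ← div_div]
    rw [hQ2] at core
    have key : L - (1+m) * Real.log (1+m) ≤ Q / (1-q) := by linarith
    have := mul_le_mul_of_nonneg_left key (sq_nonneg μ)
    rw [mul_div_assoc]
    linarith

/-- Sharp log-Sobolev inequality for the simple random walk on `Z_n`, `n ≥ 4`. -/
theorem logSobolev_simple_random_walk (n : ℕ) (hn : 4 ≤ n) (f : Fin n → ℝ)
    (hf : ∀ x, 0 ≤ f x) :
    (1 / n : ℝ) * ∑ x : Fin n, f x ^ 2 * Real.log (f x ^ 2)
      - ((1 / n : ℝ) * ∑ x : Fin n, f x ^ 2) *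
          Real.log ((1 / n : ℝ) * ∑ x : Fin n, f x ^ 2)
      ≤ (2 / (1 - Real.cos (2 * Real.pi / n))) *
          ((1 / n : ℝ) * ∑ x : Fin n,
            f x * (f x - (1 / 2) * f ⟨(x.val + 1) % n, Nat.mod_lt _ x.pos⟩
              - (1 / 2) * f ⟨(x.val + (n - 1)) % n, Nat.mod_lt _ x.pos⟩)) := by
  have hn0 : 0 < n := by omega
  obtain ⟨F, hFd⟩ : ∃ F : ℕ → ℝ, ∀ x, F x = f ⟨x % n, Nat.mod_lt _ hn0⟩ := ⟨_, fun _ => rfl⟩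
  have hFf : ∀ x : Fin n, f x = F x.val := by
    intro x; rw [hFd]; congr 1; apply Fin.ext; exact (Nat.mod_eq_of_lt x.isLt).symm
  have hFp : ∀ x, F (x + n) = F x := by
    intro x; rw [hFd, hFd]; congr 1; apply Fin.ext; exact Nat.add_mod_right x n
  have main := lsi_range n hn F (by simpa using hFp 0) (fun x => by rw [hFd]; exact hf _) _ rfl
  have c1 : ∀ g : ℕ → ℝ, (1 / n : ℝ) * ∑ x : Fin n, g x.val = lsiE n g := by
    intro g
    unfold lsiE
    rw [Fin.sum_univ_eq_sum_range g n, Finset.mul_sum]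
    exact Finset.sum_congr rfl (fun x _ => by ring)
  have e1 : (1 / n : ℝ) * ∑ x : Fin n, f x ^ 2 * Real.log (f x ^ 2) = lsiE n (fun x => F x ^ 2 * Real.log (F x ^ 2)) := by
    rw [← c1]; simp_rw [hFf]
  have e2 : (1 / n : ℝ) * ∑ x : Fin n, f x ^ 2 = lsiE n (fun x => F x ^ 2) := by
    rw [← c1]; simp_rw [hFf]
  have e3 : (1 / n : ℝ) * ∑ x : Fin n,
            f x * (f x - (1 / 2) * f ⟨(x.val + 1) % n, Nat.mod_lt _ x.pos⟩
              - (1 / 2) * f ⟨(x.val + (n - 1)) % n, Nat.mod_lt _ x.pos⟩)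
      = lsiE n (fun x => F x * (F x - 1/2 * F (x+1) - 1/2 * F (x + (n-1)))) := by
    rw [← c1]
    congr 1
    refine Finset.sum_congr rfl (fun x _ => ?_)
    rw [hFd (x.val+1), hFd (x.val + (n-1)), hFf x]
  have s1 : lsiE n (fun x => F (x+1) ^ 2) = lsiE n (fun x => F x ^ 2) := by
    unfold lsiE
    exact lsi_shift_sum n (fun x => F x ^ 2 / n) (by simp only [show F n = F 0 by simpa using hFp 0])
  have s2 : lsiE n (fun x => F x * F (x + (n-1))) = lsiE n (fun x => F x * F (x+1)) := by
    unfold lsiE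
    rw [← lsi_shift_sum n (fun x => F x * F (x + (n-1)) / n) (by
      simp only [show F n = F 0 by simpa using hFp 0, show n + (n-1) = (0 + (n-1)) + n by omega, hFp])]
    refine Finset.sum_congr rfl (fun x _ => ?_)
    rw [show x + 1 + (n-1) = x + n by omega, hFp]; ring
  have s3 : lsiE n (fun x => F x * (F x - 1/2 * F (x+1) - 1/2 * F (x + (n-1))))
      = lsiE n (fun x => F x ^ 2) - 1/2 * lsiE n (fun x => F x * F (x+1)) - 1/2 * lsiE n (fun x => F x * F (x + (n-1))) := by
    simp only [lsiE, Finset.mul_sum, ← Finset.sum_sub_distrib]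
    exact Finset.sum_congr rfl (fun x _ => by ring)
  have s4 : lsiE n (fun x => (F (x+1) - F x)^2)
      = lsiE n (fun x => F (x+1) ^ 2) + lsiE n (fun x => F x ^ 2) - 2 * lsiE n (fun x => F x * F (x+1)) := by
    simp only [lsiE, Finset.mul_sum, ← Finset.sum_sub_distrib, ← Finset.sum_add_distrib]
    exact Finset.sum_congr rfl (fun x _ => by ring)
  rw [e1, e2, e3, s3, s2]
  refine main.trans (le_of_eq ?_)
  rw [s4, s1]
  ring
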